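/- (Buch's span bound.) Fix integers 1 ≤ k ≤ n and d ≥ 0. Let M be an n×k matrix with entries in the polynomial ring ℂ[t] such that for every t ∈ ℂ the evaluated matrix M(t) has rank k, and such that every k×k minor of M (a polynomial in t) has degree at most d. For t ∈ ℂ let L(t) ⊆ ℂ^n be the column span of M(t), a k-dimensional subspace. Then the span S = span(⋃_{t ∈ ℂ} L(t)) ⊆ ℂ^n satisfies dim S ≤ k + d. -/

import Mathlib

namespace BuchSpan

open Polynomial

/-- The span of the columns of `M(t)`. -/
noncomputable def L {n k : ℕ} (M : Matrix (Fin n) (Fin k) ℂ[X]) (t : ℂ) :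
    Submodule ℂ (Fin n → ℂ) :=
  Submodule.span ℂ (Set.range fun j : Fin k => fun i : Fin n => (M i j).eval t)

lemma coeff_prod_le {ι : Type*} (s : Finset ι) (f : ι → ℂ[X]) (e : ι → ℕ)
    (h : ∀ i, (f i).natDegree ≤ e i) :
    (∏ i ∈ s, f i).coeff (∑ i ∈ s, e i) = ∏ i ∈ s, (f i).coeff (e i) := by
  classical
  induction s using Finset.induction_on with
  | empty => simp
  | insert a s ha ih =>
    rw [Finset.prod_insert ha, Finset.sum_insert ha, Finset.prod_insert ha,
      coeff_mul_add_eq_of_natDegree_le (h a)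
        ((natDegree_prod_le _ _).trans (Finset.sum_le_sum fun i _ => h i)), ih]

lemma coeff_det {k : ℕ} (N : Matrix (Fin k) (Fin k) ℂ[X]) (e : Fin k → ℕ)
    (h : ∀ i j, (N i j).natDegree ≤ e j) :
    N.det.coeff (∑ j, e j) = (Matrix.of fun i j => (N i j).coeff (e j)).det := by
  rw [Matrix.det_apply, Matrix.det_apply, finsetSum_coeff]
  refine Finset.sum_congr rfl fun σ _ => ?_
  have key := coeff_prod_le Finset.univ (fun i => N (σ i) i) e (fun i => h _ i)
  simp only [Matrix.of_apply]
  rcases Int.units_eq_one_or (Equiv.Perm.sign σ) with hs | hs <;> simp [hs, key]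

/-- A matrix with independent columns has a nonzero maximal minor. -/
lemma exists_minor {n k : ℕ} (A : Matrix (Fin n) (Fin k) ℂ)
    (hA : LinearIndependent ℂ A.col) :
    ∃ g : Fin k → Fin n, Function.Injective g ∧ (A.submatrix g id).det ≠ 0 := by
  have hr : A.rank = k := by
    rw [Matrix.rank_eq_finrank_span_cols, finrank_span_eq_card hA, Fintype.card_fin]
  rw [Matrix.rank_eq_finrank_span_row] at hr
  obtain ⟨f, hf, -, hli⟩ := Submodule.exists_fun_fin_finrank_span_eq ℂ (Set.range A.row)
  choose g hg using hf
  have hgi : Function.Injective g := fun a b hab => hli.injective (by rw [← hg a, ← hg b, hab])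
  refine ⟨g ∘ Fin.cast hr.symm, hgi.comp (Fin.cast_injective _), ?_⟩
  have h2 : LinearIndependent ℂ (A.submatrix (g ∘ Fin.cast hr.symm) id).row := by
    have h3 := hli.comp (Fin.cast hr.symm) (Fin.cast_injective _)
    have h4 : (A.submatrix (g ∘ Fin.cast hr.symm) id).row = f ∘ Fin.cast hr.symm := by
      funext a
      exact hg _
    rw [h4]
    exact h3
  rw [Matrix.linearIndependent_rows_iff_isUnit, Matrix.isUnit_iff_isUnit_det] at h2
  exact h2.ne_zero

/-- The span is controlled by the column degrees. -/
lemma span_le {n k : ℕ} (M : Matrix (Fin n) (Fin k) ℂ[X]) (e : Fin k → ℕ)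
    (h : ∀ i j, (M i j).natDegree ≤ e j) :
    Module.finrank ℂ ↥(⨆ t : ℂ, L M t) ≤ k + ∑ j, e j := by
  let b : (Σ j : Fin k, Fin (e j + 1)) → (Fin n → ℂ) :=
    fun p i => (M i p.1).coeff p.2
  have hb : (⨆ t : ℂ, L M t) ≤ Submodule.span ℂ (Set.range b) := by
    refine iSup_le fun t => Submodule.span_le.2 ?_
    rintro _ ⟨j, rfl⟩
    have : (fun i : Fin n => (M i j).eval t) =
        ∑ m : Fin (e j + 1), (t ^ (m : ℕ)) • b ⟨j, m⟩ := by
      ext i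
      rw [eval_eq_sum_range' (Nat.lt_succ_of_le (h i j)), Finset.sum_range]
      simp [b, mul_comm]
    simp only [this]
    exact Submodule.sum_mem _ fun m _ => Submodule.smul_mem _ _
      (Submodule.subset_span ⟨_, rfl⟩)
  refine (Submodule.finrank_mono hb).trans ((finrank_range_le_card b).trans ?_)
  simp [Finset.sum_add_distrib, add_comm]

lemma main {n k : ℕ} (d : ℕ) (s : ℕ) : ∀ (M : Matrix (Fin n) (Fin k) ℂ[X]) (e : Fin k → ℕ),
    (∑ j, e j = s) → (∀ i j, (M i j).natDegree ≤ e j) →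
    (∀ t, k ≤ Module.finrank ℂ (L M t)) →
    (∀ g : Fin k → Fin n, Function.Injective g →
      ((M.submatrix g id).det).natDegree ≤ d) →
    Module.finrank ℂ ↥(⨆ t : ℂ, L M t) ≤ k + d := by
  induction s with
  | zero =>
    intro M e hs he _ _
    have := span_le M e he
    omega
  | succ s ih =>
  intro M e hs he hrank hdeg
  by_cases hA : LinearIndependent ℂ (Matrix.of fun i j => (M i j).coeff (e j)).col
  · obtain ⟨g, hg, hdet⟩ := exists_minor _ hA
    refine (span_le M e he).trans (Nat.add_le_add_left ((?_ : _ ≤ _).trans (hdeg g hg)) k)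
    refine le_natDegree_of_ne_zero ?_
    rw [coeff_det (M.submatrix g id) e (fun i j => he _ j)]
    exact hdet
  · rw [Fintype.not_linearIndependent_iff] at hA
    obtain ⟨c, hc, j₀, hj₀⟩ := hA
    obtain ⟨j, hj, hmax⟩ := Finset.exists_max_image (Finset.univ.filter fun j => c j ≠ 0) e
      ⟨j₀, by simp [hj₀]⟩
    simp only [Finset.mem_filter, Finset.mem_univ, true_and] at hj hmax
    have hc' : ∀ i, ∑ l, c l * (M i l).coeff (e l) = 0 := fun i => by
      simpa using congrFun hc i
    have hej : e j ≠ 0 := by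
      intro h0
      have hli : LinearIndependent ℂ (fun j : Fin k => fun i : Fin n => (M i j).eval 0) := by
        rw [linearIndependent_iff_card_le_finrank_span, Fintype.card_fin]
        exact hrank 0
      rw [Fintype.linearIndependent_iff] at hli
      refine hj (hli c ?_ j)
      ext i
      rw [Pi.zero_apply, Finset.sum_apply]
      refine Eq.trans ?_ (hc' i)
      refine Finset.sum_congr rfl fun l _ => ?_
      by_cases hl : c l = 0
      · simp [hl]
      · have : e l = 0 := by have := hmax l hl; omega
        simp [this, coeff_zero_eq_eval_zero]
    let q : Fin k → ℂ[X] := fun l => C (c l) * X ^ (e j - e l)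
    have hqj : q j = C (c j) := by simp [q]
    let w : Fin n → ℂ[X] := fun i => ∑ l, q l • M i l
    have hterm : ∀ i l, (q l * M i l).natDegree ≤ e j ∧
        (q l * M i l).coeff (e j) = c l * (M i l).coeff (e l) := by
      intro i l
      by_cases hl : c l = 0
      · simp [q, hl]
      · have h1 := hmax l hl
        have h2 : (q l).natDegree ≤ e j - e l := natDegree_C_mul_X_pow_le _ _
        have h3 : e j - e l + e l = e j := by omega
        refine ⟨natDegree_mul_le.trans (by have := he i l; omega), ?_⟩
        have := coeff_mul_add_eq_of_natDegree_le h2 (he i l)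
        rw [h3] at this
        rw [this]
        simp [q]
    have hw : ∀ i, (w i).natDegree ≤ e j - 1 := by
      intro i
      refine natDegree_le_pred (natDegree_sum_le_of_forall_le _ _ fun l _ => (hterm i l).1) ?_
      simp only [w, finsetSum_coeff, smul_eq_mul]
      rw [← hc' i]
      exact Finset.sum_congr rfl fun l _ => (hterm i l).2
    let M' := M.updateCol j w
    have hL : ∀ t, L M t ≤ L M' t := by
      intro t
      have hne : ∀ l, l ≠ j → (fun i : Fin n => (M i l).eval t) ∈ L M' t := by
        intro l hl
        refine Submodule.subset_span ⟨l, ?_⟩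
        ext i
        simp [M', Matrix.updateCol_ne hl]
      refine Submodule.span_le.2 ?_
      rintro _ ⟨l, rfl⟩
      by_cases hl : l = j
      · subst hl
        have hwm : (fun i : Fin n => (w i).eval t) ∈ L M' t := by
          refine Submodule.subset_span ⟨l, ?_⟩
          ext i
          simp [M']
        have heq : (fun i : Fin n => (M i l).eval t) = (c l)⁻¹ • ((fun i : Fin n => (w i).eval t)
            - ∑ m ∈ Finset.univ.erase l, (q m).eval t • (fun i : Fin n => (M i m).eval t)) := by
          rw [eq_inv_smul_iff₀ hj, eq_sub_iff_add_eq]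
          ext i
          simp only [w, eval_finsetSum, smul_eq_mul, eval_mul, Pi.add_apply, Pi.smul_apply,
            Finset.sum_apply]
          rw [← Finset.add_sum_erase _ _ (Finset.mem_univ l), hqj, eval_C]
        simp only [SetLike.mem_coe]
        rw [heq]
        exact Submodule.smul_mem _ _ (Submodule.sub_mem _ hwm (Submodule.sum_mem _ fun m hm =>
          Submodule.smul_mem _ _ (hne m (Finset.ne_of_mem_erase hm))))
      · exact hne l hl
    refine (Submodule.finrank_mono (iSup_mono hL)).trans
      (ih M' (Function.update e j (e j - 1)) ?_ ?_ ?_ ?_)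
    · rw [Finset.sum_update_of_mem (Finset.mem_univ j)]
      rw [← Finset.add_sum_erase _ _ (Finset.mem_univ j)] at hs
      rw [Finset.sdiff_singleton_eq_erase]
      omega
    · intro i l
      by_cases hl : l = j
      · subst hl
        simpa [M'] using hw i
      · simpa [M', hl, Matrix.updateCol_ne] using he i l
    · exact fun t => (hrank t).trans (Submodule.finrank_mono (hL t))
    · intro g hg
      have : M'.submatrix g id = (M.submatrix g id).updateCol j
          (fun r => ∑ l, q l • (M.submatrix g id) r l) := by
        ext r l
        by_cases hl : l = j
        · subst hl; simp [M', w]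
        · simp [M', Matrix.updateCol_ne hl]
      rw [this, Matrix.det_updateCol_sum, hqj, smul_eq_mul]
      exact (natDegree_C_mul_le _ _).trans (hdeg g hg)

end BuchSpan

open Polynomial in
/-- **Buch's span bound.** Let `M` be an `n × k` matrix over `ℂ[t]` such that `M(t)`
has rank `k` for every `t ∈ ℂ` and every `k × k` minor of `M` has degree at most `d`
(so `M` encodes a morphism `f : ℙ¹ → Gr(k,n)` of degree at most `d`, with `f(t)` the
column span `L(t)` of `M(t)`). Then the span `S = span(⋃_t L(t))` of all these
`k`-dimensional subspaces satisfies `dim S ≤ k + d`. -/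
theorem buch_span_bound (n k : ℕ) (hk1 : 1 ≤ k) (hkn : k ≤ n) (d : ℕ)
    (M : Matrix (Fin n) (Fin k) ℂ[X])
    (hrank : ∀ t : ℂ, (M.map (Polynomial.eval t)).rank = k)
    (hdeg : ∀ g : Fin k → Fin n, Function.Injective g →
      ((M.submatrix g id).det).natDegree ≤ d) :
    Module.finrank ℂ
        ↥(⨆ t : ℂ, Submodule.span ℂ
            (Set.range fun j : Fin k => fun i : Fin n => (M i j).eval t)) ≤ k + d := by
  refine BuchSpan.main d _ M (fun j => Finset.univ.sup fun i => (M i j).natDegree) rfl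
    (fun i j => Finset.le_sup (f := fun i => (M i j).natDegree) (Finset.mem_univ i)) ?_ hdeg
  intro t
  have := hrank t
  rw [Matrix.rank_eq_finrank_span_cols] at this
  exact this.ge
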